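/- In M_q(n), for any subsets K, L ⊆ {1,...,n} of equal cardinality m < n, the multiplicative set S^K_L = {1, D^K_L, (D^K_L)², ...} generated by the quantum minor D^K_L satisfies the right Ore condition: for every s ∈ S^K_L and r ∈ R there exist s' ∈ S^K_L and r' ∈ R with s r' = r s'. -/

import Mathlib

open scoped BigOperators

/-- The defining relations of the quantum matrix bialgebra `M_q(n)`. -/
inductive QMatRel (k : Type*) [Field k] (q : k) (n : ℕ) :
    FreeAlgebra k (Fin n × Fin n) → FreeAlgebra k (Fin n × Fin n) → Prop
  | row (a : Fin n) {c d : Fin n} (h : c < d) :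
      QMatRel k q n (FreeAlgebra.ι k (a, c) * FreeAlgebra.ι k (a, d))
        (q • (FreeAlgebra.ι k (a, d) * FreeAlgebra.ι k (a, c)))
  | col {a b : Fin n} (c : Fin n) (h : a < b) :
      QMatRel k q n (FreeAlgebra.ι k (a, c) * FreeAlgebra.ι k (b, c))
        (q • (FreeAlgebra.ι k (b, c) * FreeAlgebra.ι k (a, c)))
  | cross1 {a b c d : Fin n} (hab : a < b) (hcd : c < d) :
      QMatRel k q n (FreeAlgebra.ι k (a, c) * FreeAlgebra.ι k (b, d))
        (FreeAlgebra.ι k (b, d) * FreeAlgebra.ι k (a, c) +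
          (q - q⁻¹) • (FreeAlgebra.ι k (b, c) * FreeAlgebra.ι k (a, d)))
  | cross2 {a b c d : Fin n} (hab : a < b) (hdc : d < c) :
      QMatRel k q n (FreeAlgebra.ι k (a, c) * FreeAlgebra.ι k (b, d))
        (FreeAlgebra.ι k (b, d) * FreeAlgebra.ι k (a, c))

/-- The quantum matrix algebra `M_q(n)`. -/
abbrev QMat (k : Type*) [Field k] (q : k) (n : ℕ) : Type _ := RingQuot (QMatRel k q n)

/-- The generator `t^i_j` of `M_q(n)`. -/
noncomputable def tgen {k : Type*} [Field k] (q : k) (n : ℕ) (i j : Fin n) : QMat k q n :=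
  RingQuot.mkAlgHom k (QMatRel k q n) (FreeAlgebra.ι k (i, j))

/-- Number of inversions of a permutation of `Fin m`. -/
def invCount {m : ℕ} (σ : Equiv.Perm (Fin m)) : ℕ :=
  (Finset.univ.filter (fun p : Fin m × Fin m => p.1 < p.2 ∧ σ p.2 < σ p.1)).card

/-- The quantum minor `D^K_L` with row set `K` and column set `L` (both of
cardinality `m`, taken in increasing order). -/
noncomputable def qMinor {k : Type*} [Field k] (q : k) {n : ℕ} (m : ℕ)
    (K L : Finset (Fin n)) (hK : K.card = m) (hL : L.card = m) : QMat k q n :=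
  ∑ σ : Equiv.Perm (Fin m), ((-q) ^ invCount σ) •
    (List.ofFn (fun i : Fin m =>
      tgen q n (K.orderIsoOfFin hK i) (L.orderIsoOfFin hL (σ i)))).prod

/-- A family `t i j`, with rows and columns indexed by linear orders, satisfying the defining
relations of the quantum matrix bialgebra. -/
structure IsQuantumMatrix {k α β R : Type*} [Field k] [LinearOrder α] [LinearOrder β] [Ring R]
    [Algebra k R] (q : k) (t : α → β → R) : Prop where
  row (a : α) {c d : β} (h : c < d) : t a c * t a d = q • (t a d * t a c)
  col {a b : α} (c : β) (h : a < b) : t a c * t b c = q • (t b c * t a c)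
  cross {a b : α} {c d : β} (hab : a < b) (hcd : c < d) :
    t a c * t b d = t b d * t a c + (q - q⁻¹) • (t b c * t a d)
  comm {a b : α} {c d : β} (hab : a < b) (hdc : d < c) : t a c * t b d = t b d * t a c

namespace Finset

variable {α : Type*} [LinearOrder α]

/-- The number of elements of `s` below `a`. -/
def numBelow (s : Finset α) (a : α) : ℕ := (s.filter (· < a)).card

/-- The number of elements of `s` above `a`. -/
def numAbove (s : Finset α) (a : α) : ℕ := (s.filter (a < ·)).card

theorem numBelow_erase {s : Finset α} {a : α} (ha : a ∈ s) (b : α) :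
    (s.erase a).numBelow b + (if a < b then 1 else 0) = s.numBelow b := by
  unfold numBelow
  rw [filter_erase]
  split_ifs with h
  · exact card_erase_add_one (by simp [ha, h])
  · rw [erase_eq_of_notMem (by simp [h]), add_zero]

theorem numAbove_erase {s : Finset α} {a : α} (ha : a ∈ s) (b : α) :
    (s.erase a).numAbove b + (if b < a then 1 else 0) = s.numAbove b := by
  unfold numAbove
  rw [filter_erase]
  split_ifs with h
  · exact card_erase_add_one (by simp [ha, h])
  · rw [erase_eq_of_notMem (by simp [h]), add_zero]

theorem numBelow_insert {s : Finset α} {a : α} (ha : a ∉ s) (b : α) :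
    (insert a s).numBelow b = s.numBelow b + (if a < b then 1 else 0) := by
  rw [← numBelow_erase (mem_insert_self a s), erase_insert ha]

theorem numAbove_insert {s : Finset α} {a : α} (ha : a ∉ s) (b : α) :
    (insert a s).numAbove b = s.numAbove b + (if b < a then 1 else 0) := by
  rw [← numAbove_erase (mem_insert_self a s), erase_insert ha]

theorem numBelow_eq_zero {s : Finset α} {a : α} (h : ∀ b ∈ s, a ≤ b) : s.numBelow a = 0 := by
  simpa [numBelow, filter_eq_empty_iff] using h

theorem numBelow_add_numAbove {s : Finset α} {a : α} (ha : a ∉ s) :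
    s.numBelow a + s.numAbove a = s.card := by
  unfold numBelow numAbove
  rw [← card_filter_add_card_filter_not (s := s) (· < a)]
  congr 2
  refine filter_congr fun x hx => ?_
  rw [not_lt]
  exact ⟨le_of_lt, fun h => lt_of_le_of_ne h fun h => ha (h ▸ hx)⟩

theorem Nonempty.exists_lt_of_mem_erase {s : Finset α} (hs : s.Nonempty) :
    ∃ a ∈ s, ∀ b ∈ s.erase a, a < b :=
  ⟨s.min' hs, s.min'_mem hs, fun _ hb => s.min'_lt_of_mem_erase_min' hs hb⟩

theorem sum_sum_erase_eq_zero {M : Type*} [AddCommMonoid M] (s : Finset α) (f : α → α → M)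
    (h : ∀ i ∈ s, ∀ j ∈ s, i < j → f i j + f j i = 0) :
    ∑ i ∈ s, ∑ j ∈ s.erase i, f i j = 0 := by
  rw [sum_sigma']
  refine sum_involution (fun p _ => ⟨p.2, p.1⟩) ?_ ?_ ?_ ?_
  · rintro ⟨i, j⟩ hp
    simp only [mem_sigma, mem_erase] at hp
    rcases lt_or_gt_of_ne hp.2.1 with hlt | hlt
    · rw [add_comm]; exact h _ hp.2.2 _ hp.1 hlt
    · exact h _ hp.1 _ hp.2.2 hlt
  · rintro ⟨i, j⟩ hp - he
    simp only [mem_sigma, mem_erase] at hp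
    simp only [Sigma.mk.injEq] at he
    exact hp.2.1 he.1
  · rintro ⟨i, j⟩ hp
    simp only [mem_sigma, mem_erase] at hp ⊢
    exact ⟨hp.2.2, hp.2.1.symm, hp.1⟩
  · rintro ⟨i, j⟩ hp
    rfl

theorem sum_sum_erase_comm {M : Type*} [AddCommMonoid M] (s : Finset α) (f : α → α → M) :
    ∑ i ∈ s, ∑ j ∈ s.erase i, f i j = ∑ j ∈ s, ∑ i ∈ s.erase j, f i j := by
  refine sum_comm' fun x y => ?_
  simp only [mem_erase]
  tauto

end Finset

open Finset

section QuantumMinor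

variable {k α β R : Type*} [Field k] [LinearOrder β] [Ring R] [Algebra k R] {q : k}
  {t : α → β → R}

/-- The quantum minor with the given list of rows (in the given order, possibly with
repetitions) and set of columns, defined by expansion along the first row. -/
def rowMinor (q : k) (t : α → β → R) : List α → Finset β → R
  | [], L => if L = ∅ then 1 else 0
  | x :: l, L => ∑ j ∈ L, (-q) ^ L.numBelow j • (t x j * rowMinor q t l (L.erase j))

theorem rowMinor_cons (x : α) (l : List α) (L : Finset β) :
    rowMinor q t (x :: l) L =
      ∑ j ∈ L, (-q) ^ L.numBelow j • (t x j * rowMinor q t l (L.erase j)) := rfl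

theorem rowMinor_cons_congr {l l' : List α} {c : k}
    (h : ∀ L, rowMinor q t l L = c • rowMinor q t l' L) (x : α) (L : Finset β) :
    rowMinor q t (x :: l) L = c • rowMinor q t (x :: l') L := by
  simp only [rowMinor_cons, h, smul_sum]
  refine sum_congr rfl fun j _ => ?_
  rw [mul_smul_comm, smul_comm]

theorem rowMinor_concat (l : List α) (x : α) (L : Finset β) :
    rowMinor q t (l ++ [x]) L =
      ∑ j ∈ L, (-q) ^ L.numAbove j • (rowMinor q t l (L.erase j) * t x j) := by
  induction l generalizing L with
  | nil =>
    refine sum_congr rfl fun j hj => ?_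
    by_cases h : L.erase j = ∅
    · obtain rfl : L = {j} := by
        rw [← insert_erase hj, h]; rfl
      simp [rowMinor, numBelow, numAbove, filter_singleton]
    · simp [rowMinor, h]
  | cons y l ih =>
    simp only [List.cons_append, rowMinor_cons, ih, mul_sum, smul_sum, sum_mul]
    rw [sum_sum_erase_comm]
    refine sum_congr rfl fun j hj => sum_congr rfl fun i hi => ?_
    have hi' := mem_of_mem_erase hi
    simp only [mul_smul_comm, smul_mul_assoc, smul_smul, ← pow_add, mul_assoc, erase_right_comm]
    congr 2
    have h1 := numBelow_erase hj i
    have h2 := numAbove_erase hi' j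
    omega

theorem rowMinor_cons_cons (x y : α) (l : List α) (L : Finset β) :
    rowMinor q t (x :: y :: l) L = ∑ i ∈ L, ∑ j ∈ L.erase i,
      (-q) ^ (L.numBelow i + (L.erase i).numBelow j) •
        (t x i * t y j * rowMinor q t l ((L.erase i).erase j)) := by
  simp only [rowMinor_cons, mul_sum, smul_sum, mul_smul_comm, smul_smul, ← pow_add, mul_assoc]

theorem commute_rowMinor {z : R} {l : List α} {L : Finset β}
    (h : ∀ i ∈ l, ∀ j ∈ L, Commute z (t i j)) : Commute z (rowMinor q t l L) := by
  induction l generalizing L with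
  | nil =>
    rw [rowMinor]
    split_ifs
    exacts [Commute.one_right z, Commute.zero_right z]
  | cons x l ih =>
    refine Commute.sum_right _ _ _ fun j hj => Commute.smul_right (Commute.mul_right ?_ ?_) _
    · exact h x (by simp) j hj
    · exact ih fun i hi j' hj' => h i (by simp [hi]) j' (mem_of_mem_erase hj')

variable [LinearOrder α]

theorem IsQuantumMatrix.transpose (ht : IsQuantumMatrix q t) :
    IsQuantumMatrix q (fun j i => t i j) where
  row a _ _ h := ht.col a h
  col c h := ht.row c h
  cross hab hcd := by rw [ht.cross hcd hab, ht.comm hcd hab]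
  comm hab hcd := (ht.comm hcd hab).symm

theorem IsQuantumMatrix.rowMinor_cons_self (ht : IsQuantumMatrix q t) (x : α) (l : List α)
    (L : Finset β) : rowMinor q t (x :: x :: l) L = 0 := by
  rw [rowMinor_cons_cons]
  refine sum_sum_erase_eq_zero _ _ fun i hi j hj hij => ?_
  have h1 := numBelow_erase hi j
  have h2 := numBelow_erase hj i
  rw [if_pos hij] at h1
  rw [if_neg hij.asymm, add_zero] at h2
  rw [← h1, h2, erase_right_comm, ht.row x hij,
    show numBelow (L.erase i) j + 1 + L.numBelow i = L.numBelow i + numBelow (L.erase i) j + 1 by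
      ring, pow_succ]
  simp [smul_smul]

theorem IsQuantumMatrix.rowMinor_cons_cons_swap (hq : q ≠ 0) (ht : IsQuantumMatrix q t) {x y : α}
    (hyx : y < x) (l : List α) (L : Finset β) :
    rowMinor q t (x :: y :: l) L = (-q) • rowMinor q t (y :: x :: l) L := by
  rw [neg_smul, eq_neg_iff_add_eq_zero, rowMinor_cons_cons, rowMinor_cons_cons]
  simp only [smul_sum, ← sum_add_distrib]
  refine sum_sum_erase_eq_zero _ _ fun i hi j hj hij => ?_
  have h1 := numBelow_erase hi j
  have h2 := numBelow_erase hj i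
  rw [if_pos hij] at h1
  rw [if_neg hij.asymm, add_zero] at h2
  rw [← h1, h2, erase_right_comm, ht.cross hyx hij, ht.comm hyx hij,
    show numBelow (L.erase i) j + 1 + L.numBelow i = L.numBelow i + numBelow (L.erase i) j + 1 by
      ring, pow_succ]
  generalize (-q) ^ (L.numBelow i + (L.erase i).numBelow j) = e
  simp only [add_mul, smul_mul_assoc, smul_add, smul_smul]
  generalize t x i * t y j * _ = A
  generalize t x j * t y i * _ = B
  match_scalars <;> field_simp <;> ring

/-- The quantum minor with row set `K` and column set `L`. -/
def quantumMinor (q : k) (t : α → β → R) (K : Finset α) (L : Finset β) : R :=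
  rowMinor q t K.sort L

theorem IsQuantumMatrix.rowMinor_cons_sort_of_mem (hq : q ≠ 0) (ht : IsQuantumMatrix q t)
    {K : Finset α} {x : α} (hx : x ∈ K) (L : Finset β) : rowMinor q t (x :: K.sort) L = 0 := by
  induction K using Finset.induction_on_min generalizing L with
  | empty => simp at hx
  | insert a s ha ih =>
    rw [sort_insert _ (fun b hb => (ha b hb).le) fun h => (ha a h).false]
    rcases mem_insert.1 hx with rfl | hx
    · exact ht.rowMinor_cons_self ..
    · rw [ht.rowMinor_cons_cons_swap hq (ha x hx),
        rowMinor_cons_congr (c := 0) (l' := []) (fun L => by rw [ih hx, zero_smul]), zero_smul,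
        smul_zero]

theorem IsQuantumMatrix.rowMinor_cons_sort (hq : q ≠ 0) (ht : IsQuantumMatrix q t)
    {K : Finset α} {x : α} (hx : x ∉ K) (L : Finset β) :
    rowMinor q t (x :: K.sort) L = (-q) ^ K.numBelow x • quantumMinor q t (insert x K) L := by
  unfold quantumMinor
  induction K using Finset.induction_on_min generalizing L with
  | empty => simp [numBelow]
  | insert a s ha ih =>
    have has : a ∉ s := fun h => (ha a h).false
    have hxs : x ∉ s := fun h => hx (mem_insert_of_mem h)
    rcases lt_or_gt_of_ne (fun h => hx (h ▸ mem_insert_self x s) : x ≠ a) with hxa | hxa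
    · have hlt : ∀ b ∈ insert a s, x < b := by
        intro b hb
        rcases mem_insert.1 hb with rfl | hb
        exacts [hxa, hxa.trans (ha b hb)]
      rw [numBelow_eq_zero fun b hb => (hlt b hb).le, sort_insert _ (fun b hb => (hlt b hb).le) hx,
        pow_zero, one_smul]
    · have hlt : ∀ b ∈ insert x s, a < b := by
        intro b hb
        rcases mem_insert.1 hb with rfl | hb
        exacts [hxa, ha b hb]
      rw [sort_insert _ (fun b hb => (ha b hb).le) has, ht.rowMinor_cons_cons_swap hq hxa,
        rowMinor_cons_congr (ih hxs), insert_comm,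
        sort_insert _ (fun b hb => (hlt b hb).le) fun h => (hlt a h).false,
        numBelow_insert has, if_pos hxa, pow_succ', smul_smul]

theorem IsQuantumMatrix.rowMinor_sort_concat (hq : q ≠ 0) (ht : IsQuantumMatrix q t)
    {K : Finset α} {x : α} (hx : x ∉ K) (L : Finset β) :
    rowMinor q t (K.sort ++ [x]) L =
      (-q) ^ K.numAbove x • quantumMinor q t (insert x K) L := by
  unfold quantumMinor
  induction K using Finset.induction_on_min generalizing L with
  | empty => simp [numAbove]
  | insert a s ha ih =>
    have has : a ∉ s := fun h => (ha a h).false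
    have hxs : x ∉ s := fun h => hx (mem_insert_of_mem h)
    rw [sort_insert _ (fun b hb => (ha b hb).le) has, List.cons_append,
      rowMinor_cons_congr (ih hxs), numAbove_insert has]
    rcases lt_or_gt_of_ne (fun h => hx (h ▸ mem_insert_self x s) : x ≠ a) with hxa | hxa
    · have hlt : ∀ b ∈ s, x < b := fun b hb => hxa.trans (ha b hb)
      have hlt' : ∀ b ∈ insert a s, x < b := by
        intro b hb
        rcases mem_insert.1 hb with rfl | hb
        exacts [hxa, hlt b hb]
      rw [sort_insert _ (fun b hb => (hlt b hb).le) hxs,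
        ht.rowMinor_cons_cons_swap hq hxa, smul_smul, sort_insert _ (fun b hb => (hlt' b hb).le) hx,
        sort_insert _ (fun b hb => (ha b hb).le) has, if_pos hxa, pow_succ]
    · have hlt : ∀ b ∈ insert x s, a < b := by
        intro b hb
        rcases mem_insert.1 hb with rfl | hb
        exacts [hxa, ha b hb]
      rw [insert_comm, sort_insert _ (fun b hb => (hlt b hb).le) fun h => (hlt a h).false,
        if_neg hxa.asymm, add_zero]

theorem IsQuantumMatrix.rowMinor_sort_concat_of_mem (hq : q ≠ 0) (ht : IsQuantumMatrix q t)
    {K : Finset α} {x : α} (hx : x ∈ K) (L : Finset β) :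
    rowMinor q t (K.sort ++ [x]) L = 0 := by
  induction K using Finset.induction_on_min generalizing L with
  | empty => simp at hx
  | insert a s ha ih =>
    have has : a ∉ s := fun h => (ha a h).false
    rw [sort_insert _ (fun b hb => (ha b hb).le) has, List.cons_append]
    rcases mem_insert.1 hx with rfl | hx
    · rw [rowMinor_cons_congr (ht.rowMinor_sort_concat hq has),
        ht.rowMinor_cons_sort_of_mem hq (mem_insert_self _ _), smul_zero]
    · rw [rowMinor_cons_congr (c := 0) (l' := []) (fun L => by rw [ih hx, zero_smul]), zero_smul]

theorem IsQuantumMatrix.sum_row_mul_quantumMinor (hq : q ≠ 0) (ht : IsQuantumMatrix q t)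
    {K : Finset α} {x : α} (hx : x ∉ K) (L : Finset β) :
    ∑ j ∈ L, (-q) ^ L.numBelow j • (t x j * quantumMinor q t K (L.erase j)) =
      (-q) ^ K.numBelow x • quantumMinor q t (insert x K) L :=
  ht.rowMinor_cons_sort hq hx L

theorem IsQuantumMatrix.sum_row_mul_quantumMinor_of_mem (hq : q ≠ 0) (ht : IsQuantumMatrix q t)
    {K : Finset α} {x : α} (hx : x ∈ K) (L : Finset β) :
    ∑ j ∈ L, (-q) ^ L.numBelow j • (t x j * quantumMinor q t K (L.erase j)) = 0 :=
  ht.rowMinor_cons_sort_of_mem hq hx L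

theorem quantumMinor_empty (L : Finset β) :
    quantumMinor q t ∅ L = if L = ∅ then 1 else 0 := by
  simp [quantumMinor, rowMinor]

theorem IsQuantumMatrix.quantumMinor_eq_sum (hq : q ≠ 0) (ht : IsQuantumMatrix q t)
    {K : Finset α} {x : α} (hx : x ∈ K) (hxK : ∀ i ∈ K.erase x, x < i) (L : Finset β) :
    quantumMinor q t K L = ∑ j ∈ L, (-q) ^ L.numBelow j •
      (t x j * quantumMinor q t (K.erase x) (L.erase j)) := by
  rw [ht.sum_row_mul_quantumMinor hq (notMem_erase x K), numBelow_eq_zero fun i hi => (hxK i hi).le,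
    pow_zero, one_smul, insert_erase hx]

theorem IsQuantumMatrix.quantumMinor_transpose (hq : q ≠ 0) (ht : IsQuantumMatrix q t)
    (K : Finset α) (L : Finset β) :
    quantumMinor q (fun j i => t i j) L K = quantumMinor q t K L := by
  induction hn : K.card using Nat.strong_induction_on generalizing K L with
  | _ n ih =>
  subst hn
  have ht' := ht.transpose
  rcases K.eq_empty_or_nonempty with rfl | hK <;> rcases L.eq_empty_or_nonempty with rfl | hL
  · simp [quantumMinor_empty]
  · obtain ⟨y, hy, hyL⟩ := hL.exists_lt_of_mem_erase
    rw [ht'.quantumMinor_eq_sum hq hy hyL, quantumMinor_empty, if_neg hL.ne_empty, sum_empty]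
  · obtain ⟨x, hx, hxK⟩ := hK.exists_lt_of_mem_erase
    rw [ht.quantumMinor_eq_sum hq hx hxK, quantumMinor_empty, if_neg hK.ne_empty, sum_empty]
  · obtain ⟨x, hx, hxK⟩ := hK.exists_lt_of_mem_erase
    obtain ⟨y, hy, hyL⟩ := hL.exists_lt_of_mem_erase
    rw [ht.quantumMinor_eq_sum hq hx hxK, ht'.quantumMinor_eq_sum hq hy hyL,
      ← add_sum_erase _ _ hx, ← add_sum_erase _ _ hy, numBelow_eq_zero (a := x),
      numBelow_eq_zero (a := y),
      ih _ (card_erase_lt_of_mem hx) (K.erase x) _ rfl]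
    · congr 1
      have h1 : ∀ i ∈ K.erase x, quantumMinor q (fun j i => t i j) (L.erase y) (K.erase i) =
          ∑ j ∈ L.erase y, (-q) ^ (L.erase y).numBelow j •
            (t x j * quantumMinor q t ((K.erase x).erase i) ((L.erase y).erase j)) := by
        intro i hi
        have hi' := mem_of_mem_erase hi
        rw [ih _ (card_erase_lt_of_mem hi') _ _ rfl, erase_right_comm]
        exact ht.quantumMinor_eq_sum hq (mem_erase.2 ⟨(ne_of_mem_erase hi).symm, hx⟩)
          (fun a ha => hxK a (erase_subset_erase _ (erase_subset _ _) ha)) _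
      have h2 : ∀ j ∈ L.erase y, quantumMinor q t (K.erase x) (L.erase j) =
          ∑ i ∈ K.erase x, (-q) ^ (K.erase x).numBelow i •
            (t i y * quantumMinor q t ((K.erase x).erase i) ((L.erase y).erase j)) := by
        intro j hj
        rw [← ih _ (card_erase_lt_of_mem hx) (K.erase x) _ rfl,
          ht'.quantumMinor_eq_sum hq (mem_erase.2 ⟨(ne_of_mem_erase hj).symm, hy⟩)
          (fun a ha => hyL a (erase_subset_erase _ (erase_subset _ _) ha))]
        refine sum_congr rfl fun i hi => ?_
        rw [ih _ ((card_erase_lt_of_mem hi).trans (card_erase_lt_of_mem hx)) _ _ rfl,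
          erase_right_comm (s := L)]
      rw [sum_congr (s₁ := K.erase x) rfl fun i hi => by rw [h1 i hi],
        sum_congr (s₁ := L.erase y) rfl fun j hj => by rw [h2 j hj]]
      simp only [mul_sum, smul_sum]
      rw [sum_comm]
      refine sum_congr rfl fun j hj => sum_congr rfl fun i hi => ?_
      rw [← numBelow_erase hx i, ← numBelow_erase hy j, if_pos (hxK i hi), if_pos (hyL j hj)]
      simp only [mul_smul_comm, smul_smul, ← pow_add, ← mul_assoc]
      rw [ht.comm (hxK i hi) (hyL j hj)]
      congr 2
      ring
    · exact fun b hb => (eq_or_ne b y).elim ge_of_eq fun h => (hyL b (mem_erase.2 ⟨h, hb⟩)).le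
    · exact fun b hb => (eq_or_ne b x).elim ge_of_eq fun h => (hxK b (mem_erase.2 ⟨h, hb⟩)).le

theorem IsQuantumMatrix.sum_quantumMinor_mul_col (hq : q ≠ 0) (ht : IsQuantumMatrix q t)
    (K : Finset α) {L : Finset β} {b : β} (hb : b ∉ L) :
    ∑ i ∈ K, (-q) ^ K.numAbove i • (quantumMinor q t (K.erase i) L * t i b) =
      (-q) ^ L.numAbove b • quantumMinor q t K (insert b L) := by
  have h := ht.transpose.rowMinor_sort_concat hq hb K
  rw [rowMinor_concat, ht.quantumMinor_transpose hq] at h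
  rw [← h]
  exact sum_congr rfl fun i _ => by rw [← ht.quantumMinor_transpose hq, quantumMinor]

theorem IsQuantumMatrix.sum_quantumMinor_mul_col_of_mem (hq : q ≠ 0) (ht : IsQuantumMatrix q t)
    (K : Finset α) {L : Finset β} {b : β} (hb : b ∈ L) :
    ∑ i ∈ K, (-q) ^ K.numAbove i • (quantumMinor q t (K.erase i) L * t i b) = 0 := by
  have h := ht.transpose.rowMinor_sort_concat_of_mem hq hb K
  rw [rowMinor_concat] at h
  rw [← h]
  exact sum_congr rfl fun i _ => by rw [← ht.quantumMinor_transpose hq, quantumMinor]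

/-- The `(j, i)` entry of the adjugate of the submatrix of `t` with rows `K` and columns `L`. -/
def quantumCofactor (q : k) (t : α → β → R) (K : Finset α) (L : Finset β) (j : β) (i : α) : R :=
  ((-q) ^ L.numBelow j * ((-q) ^ K.numBelow i)⁻¹) • quantumMinor q t (K.erase i) (L.erase j)

theorem IsQuantumMatrix.sum_mul_quantumCofactor (hq : q ≠ 0) (ht : IsQuantumMatrix q t)
    {K : Finset α} (L : Finset β) {x i : α} (hx : x ∈ K) :
    ∑ j ∈ L, t x j * quantumCofactor q t K L j i =
      if x = i then quantumMinor q t K L else 0 := by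
  have h : ∑ j ∈ L, t x j * quantumCofactor q t K L j i = ((-q) ^ K.numBelow i)⁻¹ •
      ∑ j ∈ L, (-q) ^ L.numBelow j • (t x j * quantumMinor q t (K.erase i) (L.erase j)) := by
    rw [smul_sum]
    refine sum_congr rfl fun j _ => ?_
    rw [quantumCofactor, mul_smul_comm, smul_smul, mul_comm]
  rw [h]
  split_ifs with hxi
  · subst hxi
    have := numBelow_erase hx x
    rw [if_neg (lt_irrefl x), add_zero] at this
    rw [ht.sum_row_mul_quantumMinor hq (notMem_erase x K), insert_erase hx, this,
      inv_smul_smul₀ (pow_ne_zero _ (neg_ne_zero.2 hq))]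
  · rw [ht.sum_row_mul_quantumMinor_of_mem hq (mem_erase.2 ⟨hxi, hx⟩), smul_zero]

theorem sum_quantumCofactor_mul (hq : q ≠ 0) (K : Finset α) (L : Finset β) (j b : β) :
    ∑ i ∈ K, quantumCofactor q t K L j i * t i b =
      ((-q) ^ (L.numBelow j + 1) * ((-q) ^ K.card)⁻¹) •
        ∑ i ∈ K, (-q) ^ K.numAbove i • (quantumMinor q t (K.erase i) (L.erase j) * t i b) := by
  rw [smul_sum]
  refine sum_congr rfl fun i hi => ?_
  rw [quantumCofactor, smul_mul_assoc, smul_smul]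
  congr 1
  have h1 := numBelow_add_numAbove (notMem_erase i K)
  have h2 := numBelow_erase hi i
  have h3 := numAbove_erase hi i
  rw [if_neg (lt_irrefl i), add_zero] at h2 h3
  rw [← card_erase_add_one hi, ← h1, h2, h3]
  have := neg_ne_zero.2 hq
  field_simp
  ring

theorem IsQuantumMatrix.sum_quantumCofactor_mul_of_mem (hq : q ≠ 0) (ht : IsQuantumMatrix q t)
    {K : Finset α} {L : Finset β} (hKL : K.card = L.card) {j b : β} (hj : j ∈ L) (hb : b ∈ L) :
    ∑ i ∈ K, quantumCofactor q t K L j i * t i b =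
      if j = b then quantumMinor q t K L else 0 := by
  rw [sum_quantumCofactor_mul hq]
  split_ifs with hjb
  · subst hjb
    have h1 := numBelow_add_numAbove (notMem_erase j L)
    have h2 := numBelow_erase hj j
    rw [if_neg (lt_irrefl j), add_zero] at h2
    rw [ht.sum_quantumMinor_mul_col hq K (notMem_erase j L), insert_erase hj, hKL,
      ← card_erase_add_one hj, ← h1, h2, smul_smul]
    have := neg_ne_zero.2 hq
    convert one_smul k _
    field_simp
    ring
  · rw [ht.sum_quantumMinor_mul_col_of_mem hq K (mem_erase.2 ⟨Ne.symm hjb, hb⟩), smul_zero]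

theorem IsQuantumMatrix.quantumMinor_mul_eq (hq : q ≠ 0) (ht : IsQuantumMatrix q t)
    {K : Finset α} (L : Finset β) {x : α} (hx : x ∈ K) (b : β) :
    quantumMinor q t K L * t x b =
      ∑ j ∈ L, t x j * ∑ i ∈ K, quantumCofactor q t K L j i * t i b := by
  simp only [mul_sum, ← mul_assoc]
  rw [sum_comm]
  simp only [← sum_mul, ht.sum_mul_quantumCofactor hq L hx]
  simp [ite_mul, hx]

/-- A quantum minor commutes with the entries of its submatrix. -/
theorem IsQuantumMatrix.commute_quantumMinor (hq : q ≠ 0) (ht : IsQuantumMatrix q t)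
    {K : Finset α} {L : Finset β} (hKL : K.card = L.card) {x : α} (hx : x ∈ K) {y : β}
    (hy : y ∈ L) : Commute (quantumMinor q t K L) (t x y) := by
  rw [Commute, SemiconjBy, ht.quantumMinor_mul_eq hq L hx,
    sum_congr rfl fun j hj => by rw [ht.sum_quantumCofactor_mul_of_mem hq hKL hj hy]]
  simp [hy]

theorem IsQuantumMatrix.mul_quantumMinor_eq (hq : q ≠ 0) (ht : IsQuantumMatrix q t)
    {K : Finset α} {L : Finset β} (hKL : K.card = L.card) {x : α} (hx : x ∈ K) {b : β}
    (hb : b ∉ L) :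
    t x b * quantumMinor q t K L = ∑ j ∈ L, (if b < j then q else q⁻¹) •
      (t x j * ∑ i ∈ K, quantumCofactor q t K L j i * t i b) := by
  have hq' := neg_ne_zero.2 hq
  have h := ht.sum_row_mul_quantumMinor_of_mem hq hx (insert b L)
  rw [sum_insert hb, erase_insert hb, add_eq_zero_iff_eq_neg,
    ← eq_inv_smul_iff₀ (pow_ne_zero _ hq'), ← sum_neg_distrib, smul_sum] at h
  rw [h]
  refine sum_congr rfl fun j hj => ?_
  have hbj : b ≠ j := fun h => hb (h ▸ hj)
  have hbL : b ∉ L.erase j := fun h => hb (mem_of_mem_erase h)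
  have h1 := numBelow_add_numAbove hb
  have h2 := numAbove_erase hj b
  have h3 := numBelow_insert hb j
  have h4 := numBelow_insert hb b
  rw [if_neg (lt_irrefl b), add_zero] at h4
  rw [erase_insert_of_ne hbj, sum_quantumCofactor_mul hq, ht.sum_quantumMinor_mul_col hq K hbL,
    h3, h4, hKL, ← h1, ← h2, mul_smul_comm, mul_smul_comm, smul_neg, smul_smul, smul_smul,
    smul_smul, ← neg_smul]
  congr 1
  split_ifs <;> field_simp <;> ring

theorem IsQuantumMatrix.sum_quantumCofactor_mul_mul_quantumMinor (hq : q ≠ 0)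
    (ht : IsQuantumMatrix q t) {K : Finset α} {L : Finset β} (hKL : K.card = L.card) {j b : β}
    (hj : j ∈ L) (hb : b ∉ L) :
    (∑ i ∈ K, quantumCofactor q t K L j i * t i b) * quantumMinor q t K L =
      (if b < j then q else q⁻¹) •
        (quantumMinor q t K L * ∑ i ∈ K, quantumCofactor q t K L j i * t i b) := by
  rw [sum_mul]
  calc _ = ∑ i ∈ K, ∑ l ∈ L, (quantumCofactor q t K L j i * t i l) *
        ((if b < l then q else q⁻¹) • ∑ i ∈ K, quantumCofactor q t K L l i * t i b) := by
        refine sum_congr rfl fun i hi => ?_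
        simp only [mul_assoc, ht.mul_quantumMinor_eq hq hKL hi hb, mul_sum (s := L),
          mul_smul_comm]
    _ = _ := by
        rw [sum_comm]
        simp only [← sum_mul (s := K)]
        rw [sum_congr rfl fun l hl => by rw [ht.sum_quantumCofactor_mul_of_mem hq hKL hj hl]]
        refine (sum_eq_single_of_mem j hj fun l _ hl => ?_).trans ?_
        · rw [if_neg hl.symm, zero_mul]
        · rw [if_pos rfl, mul_smul_comm]

end QuantumMinor

/-- The elements `r` such that for every `n` some `r * D ^ N` is a right multiple of `D ^ n`. -/
def oreSubalgebra (k : Type*) {R : Type*} [Field k] [Ring R] [Algebra k R] (D : R) :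
    Subalgebra k R where
  carrier := {r | ∀ n : ℕ, ∃ (N : ℕ) (r' : R), r * D ^ N = D ^ n * r'}
  mul_mem' {a b} ha hb n := by
    obtain ⟨N, a', ha⟩ := ha n
    obtain ⟨M, b', hb⟩ := hb N
    exact ⟨M, a' * b', by rw [mul_assoc, hb, ← mul_assoc, ha, mul_assoc]⟩
  add_mem' {a b} ha hb n := by
    obtain ⟨N, a', ha⟩ := ha n
    obtain ⟨M, b', hb⟩ := hb n
    refine ⟨N + M, a' * D ^ M + b' * D ^ N, ?_⟩
    rw [add_mul, pow_add, ← mul_assoc, ha, ← pow_add, add_comm N, pow_add, ← mul_assoc b, hb]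
    simp only [mul_add, mul_assoc]
  algebraMap_mem' c n := ⟨n, algebraMap k R c, Algebra.commutes _ _⟩

section OreSubalgebra

variable {k R : Type*} [Field k] [Ring R] [Algebra k R] {D r : R}

theorem mem_oreSubalgebra_of_mul_eq_smul {c : k} (h : r * D = c • (D * r)) :
    r ∈ oreSubalgebra k D := by
  refine fun n => ⟨n, c ^ n • r, ?_⟩
  induction n with
  | zero => simp
  | succ n ih =>
    rw [pow_succ, ← mul_assoc, ih, mul_smul_comm, smul_mul_assoc, mul_assoc, h, mul_smul_comm,
      smul_smul, mul_smul_comm, ← pow_succ, ← pow_succ, ← mul_assoc, ← pow_succ]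

theorem mem_oreSubalgebra_of_commute (h : Commute r D) : r ∈ oreSubalgebra k D :=
  mem_oreSubalgebra_of_mul_eq_smul (c := (1 : k)) (by rw [one_smul, h.eq])

theorem mem_oreSubalgebra_of_mul_mem (h : r * D ∈ oreSubalgebra k D) :
    r ∈ oreSubalgebra k D := by
  intro n
  obtain ⟨N, r', h⟩ := h n
  exact ⟨N + 1, r', by rw [pow_succ', ← mul_assoc, h]⟩

theorem mem_oreSubalgebra_of_smul_mem {c : k} (hc : c ≠ 0) (h : c • r ∈ oreSubalgebra k D) :
    r ∈ oreSubalgebra k D := by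
  simpa [smul_smul, hc] using (oreSubalgebra k D).smul_mem h c⁻¹

theorem exists_mul_eq_mul_of_mem_closure (h : r ∈ oreSubalgebra k D) {s : R}
    (hs : s ∈ Submonoid.closure {D}) :
    ∃ s' ∈ Submonoid.closure {D}, ∃ r' : R, s * r' = r * s' := by
  obtain ⟨n, rfl⟩ := Submonoid.mem_closure_singleton.1 hs
  obtain ⟨N, r', h⟩ := h n
  exact ⟨D ^ N, Submonoid.mem_closure_singleton.2 ⟨N, rfl⟩, r', h.symm⟩

end OreSubalgebra

section

variable {k α β R : Type*} [Field k] [LinearOrder α] [LinearOrder β] [Ring R] [Algebra k R]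
  {q : k} {t : α → β → R} {K : Finset α} {L : Finset β}

namespace IsQuantumMatrix

theorem mem_oreSubalgebra_of_mem_of_mem (hq : q ≠ 0) (ht : IsQuantumMatrix q t)
    (hKL : K.card = L.card) {a : α} (ha : a ∈ K) {b : β} (hb : b ∈ L) :
    t a b ∈ oreSubalgebra k (quantumMinor q t K L) :=
  mem_oreSubalgebra_of_commute (ht.commute_quantumMinor hq hKL ha hb).symm

theorem mem_oreSubalgebra_of_mem_row (hq : q ≠ 0) (ht : IsQuantumMatrix q t)
    (hKL : K.card = L.card) {a : α} (ha : a ∈ K) (b : β) :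
    t a b ∈ oreSubalgebra k (quantumMinor q t K L) := by
  by_cases hb : b ∈ L
  · exact ht.mem_oreSubalgebra_of_mem_of_mem hq hKL ha hb
  · apply mem_oreSubalgebra_of_mul_mem
    rw [ht.mul_quantumMinor_eq hq hKL ha hb]
    exact sum_mem fun j hj => Subalgebra.smul_mem _
      (mul_mem (ht.mem_oreSubalgebra_of_mem_of_mem hq hKL ha hj)
        (mem_oreSubalgebra_of_mul_eq_smul
          (ht.sum_quantumCofactor_mul_mul_quantumMinor hq hKL hj hb))) _

theorem mem_oreSubalgebra_of_mem_col (hq : q ≠ 0) (ht : IsQuantumMatrix q t)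
    (hKL : K.card = L.card) (a : α) {b : β} (hb : b ∈ L) :
    t a b ∈ oreSubalgebra k (quantumMinor q t K L) := by
  rw [← ht.quantumMinor_transpose hq]
  exact ht.transpose.mem_oreSubalgebra_of_mem_row hq hKL.symm hb a

theorem quantumMinor_insert_erase_mem_oreSubalgebra (hq : q ≠ 0) (ht : IsQuantumMatrix q t)
    (hKL : K.card = L.card) {b j : β} (hj : j ∈ L) (hb : b ∉ L) :
    quantumMinor q t K (insert b (L.erase j)) ∈ oreSubalgebra k (quantumMinor q t K L) := by
  have hq' := neg_ne_zero.2 hq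
  have h := mem_oreSubalgebra_of_mul_eq_smul
    (ht.sum_quantumCofactor_mul_mul_quantumMinor hq hKL hj hb)
  rw [sum_quantumCofactor_mul hq,
    ht.sum_quantumMinor_mul_col hq K fun h => hb (mem_of_mem_erase h)] at h
  exact mem_oreSubalgebra_of_smul_mem (pow_ne_zero _ hq') <|
    mem_oreSubalgebra_of_smul_mem
      (mul_ne_zero (pow_ne_zero _ hq') (inv_ne_zero (pow_ne_zero _ hq'))) h

theorem commute_quantumMinor_of_subset (hq : q ≠ 0) (ht : IsQuantumMatrix q t) {I : Finset α}
    {J : Finset β} (hIJ : I.card = J.card) (hKI : K ⊆ I) (hLJ : L ⊆ J) :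
    Commute (quantumMinor q t I J) (quantumMinor q t K L) :=
  commute_rowMinor fun _ hi _ hj =>
    ht.commute_quantumMinor hq hIJ (hKI (by simpa using hi)) (hLJ hj)

theorem mem_oreSubalgebra (hq : q ≠ 0) (ht : IsQuantumMatrix q t) (hKL : K.card = L.card)
    (a : α) (b : β) : t a b ∈ oreSubalgebra k (quantumMinor q t K L) := by
  by_cases ha : a ∈ K
  · exact ht.mem_oreSubalgebra_of_mem_row hq hKL ha b
  by_cases hb : b ∈ L
  · exact ht.mem_oreSubalgebra_of_mem_col hq hKL a hb
  have h := ht.sum_row_mul_quantumMinor hq ha (insert b L)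
  rw [sum_insert hb, erase_insert hb] at h
  refine mem_oreSubalgebra_of_mul_mem (mem_oreSubalgebra_of_smul_mem
    (pow_ne_zero _ (neg_ne_zero.2 hq)) (eq_sub_of_add_eq h ▸ sub_mem ?_ (sum_mem fun j hj => ?_)))
  · refine Subalgebra.smul_mem _ (mem_oreSubalgebra_of_commute ?_) _
    exact ht.commute_quantumMinor_of_subset hq (by rw [card_insert_of_notMem ha,
      card_insert_of_notMem hb, hKL]) (subset_insert _ _) (subset_insert _ _)
  · rw [erase_insert_of_ne fun h : b = j => hb (h ▸ hj)]
    exact Subalgebra.smul_mem _ (mul_mem (ht.mem_oreSubalgebra_of_mem_col hq hKL a hj)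
      (ht.quantumMinor_insert_erase_mem_oreSubalgebra hq hKL hj hb)) _

end IsQuantumMatrix

end

/-- The permutation of `Fin (m + 1)` sending `0` to `p` and acting as `τ` on the remaining
elements, in increasing order. -/
noncomputable def Fin.consPerm {m : ℕ} (p : Fin (m + 1)) (τ : Equiv.Perm (Fin m)) :
    Equiv.Perm (Fin (m + 1)) :=
  Equiv.ofBijective (Fin.cons p (p.succAbove ∘ τ)) <| Finite.injective_iff_bijective.1 <|
    Fin.cons_injective_iff.2 ⟨by rintro ⟨i, hi⟩; exact p.succAbove_ne _ hi,
      p.succAbove_right_injective.comp τ.injective⟩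

@[simp]
theorem Fin.consPerm_zero {m : ℕ} (p : Fin (m + 1)) (τ : Equiv.Perm (Fin m)) :
    Fin.consPerm p τ 0 = p := rfl

@[simp]
theorem Fin.consPerm_succ {m : ℕ} (p : Fin (m + 1)) (τ : Equiv.Perm (Fin m)) (i : Fin m) :
    Fin.consPerm p τ i.succ = p.succAbove (τ i) := rfl

theorem Fin.consPerm_bijective (m : ℕ) :
    Function.Bijective fun x : Fin (m + 1) × Equiv.Perm (Fin m) => Fin.consPerm x.1 x.2 := by
  refine (Fintype.bijective_iff_injective_and_card _).2 ⟨?_, ?_⟩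
  · rintro ⟨p, τ⟩ ⟨p', τ'⟩ h
    obtain rfl : p = p' := by simpa using Equiv.congr_fun h 0
    refine Prod.ext rfl (Equiv.ext fun i => ?_)
    simpa using Equiv.congr_fun h i.succ
  · simp [Fintype.card_perm, Nat.factorial_succ]

theorem invCount_consPerm {m : ℕ} (p : Fin (m + 1)) (τ : Equiv.Perm (Fin m)) :
    invCount (Fin.consPerm p τ) = p + invCount τ := by
  simp only [invCount, card_filter, Fintype.sum_prod_type, Fin.sum_univ_succ, Fin.consPerm_zero,
    Fin.consPerm_succ, Fin.succ_lt_succ_iff, Fin.succ_pos, true_and, Fin.not_lt_zero, false_and,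
    if_false, zero_add, p.strictMono_succAbove.lt_iff_lt, Fin.succAbove_lt_iff_castSucc_lt]
  congr 1
  rw [Equiv.sum_comp τ fun i => if i.castSucc < p then 1 else 0, ← card_filter]
  simp only [Fin.lt_def, Fin.val_castSucc, Fin.card_filter_val_lt,
    min_eq_right (Nat.lt_succ_iff.1 p.isLt)]

theorem Finset.numBelow_image_univ {m : ℕ} {β : Type*} [LinearOrder β] {c : Fin m → β}
    (hc : StrictMono c) (p : Fin m) : (univ.image c).numBelow (c p) = p := by
  rw [numBelow, filter_image, card_image_of_injective _ hc.injective]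
  simp only [hc.lt_iff_lt, Fin.lt_def, Fin.card_filter_val_lt, min_eq_right p.isLt.le]

theorem Finset.erase_image_univ {m : ℕ} {β : Type*} [DecidableEq β] {c : Fin (m + 1) → β}
    (hc : Function.Injective c) (p : Fin (m + 1)) :
    (univ.image c).erase (c p) = univ.image (c ∘ p.succAbove) := by
  rw [← image_image, ← image_erase hc]
  congr 1
  ext i
  simp

theorem sum_perm_eq_rowMinor {k α β R : Type*} [Field k] [LinearOrder β] [Ring R] [Algebra k R]
    (q : k) (t : α → β → R) {m : ℕ} (r : Fin m → α) {c : Fin m → β} (hc : StrictMono c) :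
    ∑ σ : Equiv.Perm (Fin m), (-q) ^ invCount σ •
      (List.ofFn fun i => t (r i) (c (σ i))).prod = rowMinor q t (List.ofFn r) (univ.image c) := by
  induction m with
  | zero => simp [rowMinor, invCount]
  | succ m ih =>
    rw [← (Fin.consPerm_bijective m).sum_comp, Fintype.sum_prod_type, List.ofFn_succ,
      rowMinor_cons, sum_image fun _ _ _ _ h => hc.injective h]
    refine sum_congr rfl fun p _ => ?_
    rw [numBelow_image_univ hc, erase_image_univ hc.injective,
      ← ih _ (hc.comp p.strictMono_succAbove), mul_sum, smul_sum]
    refine sum_congr rfl fun τ _ => ?_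
    simp [invCount_consPerm, pow_add, List.ofFn_succ, smul_smul]

theorem isQuantumMatrix_tgen {k : Type*} [Field k] (q : k) (n : ℕ) :
    IsQuantumMatrix q (tgen q n) where
  row a _ _ h := by
    simpa [tgen] using RingQuot.mkAlgHom_rel k (QMatRel.row (q := q) a h)
  col c h := by
    simpa [tgen] using RingQuot.mkAlgHom_rel k (QMatRel.col (q := q) c h)
  cross hab hcd := by
    simpa [tgen] using RingQuot.mkAlgHom_rel k (QMatRel.cross1 (q := q) hab hcd)
  comm hab hcd := by
    simpa [tgen] using RingQuot.mkAlgHom_rel k (QMatRel.cross2 (q := q) hab hcd)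

theorem qMinor_eq_quantumMinor {k : Type*} [Field k] (q : k) {n : ℕ} (m : ℕ)
    (K L : Finset (Fin n)) (hK : K.card = m) (hL : L.card = m) :
    qMinor q m K L hK hL = quantumMinor q (tgen q n) K L := by
  have h := sum_perm_eq_rowMinor q (tgen q n) (K.orderEmbOfFin hK) (L.orderEmbOfFin hL).strictMono
  rw [image_orderEmbOfFin_univ, List.ofFn_eq_map, listMap_orderEmbOfFin_finRange] at h
  exact h

/-- The generators `t^i_j` generate `M_q(n)` as an algebra. -/
theorem eq_top_of_tgen_mem {k : Type*} [Field k] {q : k} {n : ℕ} {S : Subalgebra k (QMat k q n)}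
    (h : ∀ i j, tgen q n i j ∈ S) : S = ⊤ := by
  refine top_le_iff.1 fun r _ => ?_
  obtain ⟨x, rfl⟩ := RingQuot.mkAlgHom_surjective k (QMatRel k q n) r
  induction x using FreeAlgebra.induction with
  | grade0 c => simp
  | grade1 x => exact h x.1 x.2
  | mul a b ha hb => simpa using S.mul_mem (ha trivial) (hb trivial)
  | add a b ha hb => simpa using S.add_mem (ha trivial) (hb trivial)

/-- The multiplicative set generated by a quantum minor `D^K_L` (with
`|K| = |L| = m < n`) satisfies the right Ore condition in `M_q(n)`. -/
theorem qMinor_rightOre {k : Type*} [Field k] (q : k) (hq : q ≠ 0)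
    {n : ℕ} (m : ℕ) (hm : m < n) (K L : Finset (Fin n))
    (hK : K.card = m) (hL : L.card = m) :
    ∀ s ∈ Submonoid.closure {qMinor q m K L hK hL}, ∀ r : QMat k q n,
      ∃ s' ∈ Submonoid.closure {qMinor q m K L hK hL}, ∃ r' : QMat k q n,
        s * r' = r * s' := by
  intro s hs r
  rw [qMinor_eq_quantumMinor] at hs ⊢
  refine exists_mul_eq_mul_of_mem_closure (k := k) ?_ hs
  rw [eq_top_of_tgen_mem ((isQuantumMatrix_tgen q n).mem_oreSubalgebra hq (hK.trans hL.symm))]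
  trivial
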